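/- arXiv:2103.08660 — 2 statements merged into one kernel-verified Lean document; each statement's English description precedes it below -/
import Mathlib

section
/- Let N be even and let z ∈ ℂ^N be analytic with ẑ_{N/2} ≠ 0. For γ ∈ ℝ, the γ-translation z^γ_tr of z is analytic if and only if γ ∈ ℤ. -/
/-- The discrete Fourier transform of a signal `z ∈ ℂ^N`:
`ẑ_k = ∑_{n=0}^{N-1} z_n e^{-2πikn/N}`. -/
noncomputable def dft (N : ℕ) (z : ℕ → ℂ) (k : ℕ) : ℂ :=
  ∑ n ∈ Finset.range N,
    z n * Complex.exp (-2 * (Real.pi : ℂ) * Complex.I * (k : ℂ) * (n : ℂ) / (N : ℂ))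

/-- For even `N`, a signal `z ∈ ℂ^N` is analytic if `ẑ_0 ∈ ℝ`, `ẑ_{N/2} ∈ ℝ`, and
`ẑ_k = 0` for all `N/2 + 1 ≤ k ≤ N - 1`. -/
def IsAnalyticEven (N : ℕ) (z : ℕ → ℂ) : Prop :=
  (dft N z 0).im = 0 ∧ (dft N z (N / 2)).im = 0 ∧
    ∀ k, N / 2 + 1 ≤ k → k ≤ N - 1 → dft N z k = 0

/-- Let `N` be even and `z ∈ ℂ^N` analytic with `ẑ_{N/2} ≠ 0`.  For `γ ∈ ℝ`, the
`γ`-translation of `z` (defined through its DFT by `(ẑ^γ_tr)_k = ẑ_k e^{2πikγ/N}`)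
is analytic if and only if `γ ∈ ℤ`. -/
theorem translation_analytic_iff_integer (N : ℕ) (hN : 0 < N) (hNeven : Even N)
    (z : ℕ → ℂ) (hz : IsAnalyticEven N z) (hhalf : dft N z (N / 2) ≠ 0)
    (γ : ℝ) (u : ℕ → ℂ)
    (hu : ∀ k < N, dft N u k =
      dft N z k * Complex.exp (2 * (Real.pi : ℂ) * Complex.I * (k : ℂ) * (γ : ℂ) / (N : ℂ))) :
    IsAnalyticEven N u ↔ ∃ m : ℤ, γ = (m : ℝ) := by
  have hu0 : dft N u 0 = dft N z 0 := by simpa using hu 0 hN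
  have hmid : dft N u (N / 2) = dft N z (N / 2) * Complex.exp ((Real.pi * γ : ℝ) * Complex.I) := by
    rw [hu _ (Nat.div_lt_self hN one_lt_two), Nat.cast_div hNeven.two_dvd two_ne_zero]
    have hN' : (N : ℂ) ≠ 0 := Nat.cast_ne_zero.mpr hN.ne'
    congr 2
    push_cast
    field_simp
  obtain ⟨hz0, hzmid, hzneg⟩ := hz
  have him : (dft N u (N / 2)).im = (dft N z (N / 2)).re * Real.sin (Real.pi * γ) := by
    rw [hmid, Complex.mul_im, hzmid, Complex.exp_ofReal_mul_I_im, zero_mul, add_zero]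
  have hre : (dft N z (N / 2)).re ≠ 0 := fun h => hhalf (Complex.ext h hzmid)
  have hneg : ∀ k, N / 2 + 1 ≤ k → k ≤ N - 1 → dft N u k = 0 := fun k h₁ h₂ => by
    rw [hu k (by omega), hzneg k h₁ h₂, zero_mul]
  have hiff : IsAnalyticEven N u ↔ Real.sin (Real.pi * γ) = 0 := by
    simpa [IsAnalyticEven, hu0, hz0, him, hre] using fun _ => hneg
  rw [hiff, Real.sin_eq_zero_iff]
  refine exists_congr fun m => ?_
  rw [mul_comm, mul_right_inj' Real.pi_ne_zero, eq_comm]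
end

section
/- Let r ∈ ℕ with r ≥ 5 and w = e^{2πi/r}. Then there exists i ∈ {1, 2, …, r−1} such that 1 + w^{3i} ≠ 0 and (w^{i} + w^{2i})/(1 + w^{3i}) ≠ 1. -/
/-- The primitive `r`-th root of unity `w = e^{2πi/r}`. -/
noncomputable def wroot (r : ℕ) : ℂ :=
  Complex.exp (2 * (Real.pi : ℂ) * Complex.I / (r : ℂ))

theorem wroot_isPrimitiveRoot {r : ℕ} (hr : r ≠ 0) : IsPrimitiveRoot (wroot r) r :=
  Complex.isPrimitiveRoot_exp r hr

/-- The bad values of `x` are `1` and the cube roots of `-1`, because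
`1 + x ^ 3 - (x + x ^ 2) = (1 - x) ^ 2 * (1 + x)`. -/
theorem add_sq_div_one_add_cube_ne_one {K : Type*} [Field K] {x : K}
    (h1 : x ≠ 1) (h3 : 1 + x ^ 3 ≠ 0) : (x + x ^ 2) / (1 + x ^ 3) ≠ 1 := by
  intro h
  rw [div_eq_one_iff_eq h3] at h
  have hprod : (1 - x) ^ 2 * (1 + x) = 0 := by linear_combination -h
  rcases mul_eq_zero.mp hprod with h0 | h0
  · exact h1 (sub_eq_zero.mp (pow_eq_zero_iff two_ne_zero |>.mp h0)).symm
  · exact h3 (by linear_combination (1 - x + x ^ 2) * h0)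

/-- Lemma 2.3 (3): for `r ≥ 5` and `w = e^{2πi/r}` there exists
`i ∈ {1, …, r-1}` with `1 + w^{3i} ≠ 0` and `(w^i + w^{2i})/(1 + w^{3i}) ≠ 1`. -/
theorem exists_good_index_part3 (r : ℕ) (hr : 5 ≤ r) :
    ∃ i : ℕ, 1 ≤ i ∧ i ≤ r - 1 ∧
      1 + wroot r ^ (3 * i) ≠ 0 ∧
      (wroot r ^ i + wroot r ^ (2 * i)) / (1 + wroot r ^ (3 * i)) ≠ 1 := by
  have hw := wroot_isPrimitiveRoot (r := r) (by omega)
  suffices ∃ i : ℕ, 1 ≤ i ∧ i ≤ r - 1 ∧ 1 + (wroot r ^ i) ^ 3 ≠ 0 by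
    obtain ⟨i, hi1, hi2, h3⟩ := this
    have h1 := hw.pow_ne_one_of_pos_of_lt (l := i) (by omega) (by omega)
    refine ⟨i, hi1, hi2, ?_⟩
    rw [mul_comm 3 i, mul_comm 2 i, pow_mul, pow_mul]
    exact ⟨h3, add_sq_div_one_add_cube_ne_one h1 h3⟩
  by_cases h6 : r = 6
  · subst h6
    refine ⟨2, by norm_num, by norm_num, ?_⟩
    rw [← pow_mul, hw.pow_eq_one]
    norm_num
  · refine ⟨1, le_rfl, by omega, fun h => ?_⟩
    rw [pow_one] at h
    have hpow : wroot r ^ 6 = 1 := by linear_combination (wroot r ^ 3 - 1) * h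
    have hdvd := hw.dvd_of_pow_eq_one 6 hpow
    have hle := Nat.le_of_dvd (by norm_num) hdvd
    obtain rfl : r = 5 := by omega
    revert hdvd
    decide
end
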